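/- Let P be the Pell sequence (P_0 = 0, P_1 = 1, P_n = 2P_{n-1} + P_{n-2}) and Q the associated Pell sequence (Q_0 = 1, Q_1 = 1, Q_n = 2Q_{n-1} + Q_{n-2}). For every k ≥ 1, the greatest common divisor of the set { Σ_{i=1}^{k} Q_{n+i} : n ≥ 0 } of all sums of k consecutive associated Pell numbers equals 2·P_{k/2} if k ≡ 0 (mod 4), equals 2·Q_{k/2} if k ≡ 2 (mod 4), and equals 1 if k is odd. -/

import Mathlib

/-- The Pell sequence: P₀ = 0, P₁ = 1, Pₙ = 2Pₙ₋₁ + Pₙ₋₂. -/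
def pell : ℕ → ℤ
  | 0 => 0
  | 1 => 1
  | n + 2 => 2 * pell (n + 1) + pell n

/-- The associated Pell sequence: Q₀ = 1, Q₁ = 1, Qₙ = 2Qₙ₋₁ + Qₙ₋₂. -/
def assocPell : ℕ → ℤ
  | 0 => 1
  | 1 => 1
  | n + 2 => 2 * assocPell (n + 1) + assocPell n

/-- `d` is the greatest common divisor of the set `{S n : n ≥ 0}`: `d ≥ 1`, `d` divides
every element of the set, and every common divisor of the set divides `d`. -/
def IsSetGCD (S : ℕ → ℤ) (d : ℤ) : Prop :=
  1 ≤ d ∧ (∀ n : ℕ, d ∣ S n) ∧ ∀ e : ℤ, (∀ n : ℕ, e ∣ S n) → e ∣ d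

theorem pell_succ_and_assocPell_succ (n : ℕ) :
    pell (n + 1) = pell n + assocPell n ∧ assocPell (n + 1) = assocPell n + 2 * pell n := by
  induction n with
  | zero => simp [pell, assocPell]
  | succ n ih =>
    obtain ⟨hp, hq⟩ := ih
    simp only [pell, assocPell]
    constructor <;> linarith

theorem pell_succ (n : ℕ) : pell (n + 1) = pell n + assocPell n :=
  (pell_succ_and_assocPell_succ n).1

theorem assocPell_succ (n : ℕ) : assocPell (n + 1) = assocPell n + 2 * pell n :=
  (pell_succ_and_assocPell_succ n).2

theorem pell_add_and_assocPell_add (a m : ℕ) :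
    pell (a + m) = pell a * assocPell m + assocPell a * pell m ∧
      assocPell (a + m) = assocPell a * assocPell m + 2 * pell a * pell m := by
  induction m with
  | zero => simp [pell, assocPell]
  | succ m ih =>
    obtain ⟨hp, hq⟩ := ih
    rw [← add_assoc, pell_succ (a + m), assocPell_succ (a + m), pell_succ m, assocPell_succ m, hp,
      hq]
    constructor <;> ring

theorem assocPell_sq_sub (m : ℕ) : assocPell m ^ 2 - 2 * pell m ^ 2 = (-1) ^ m := by
  induction m with
  | zero => simp [pell, assocPell]
  | succ m ih =>
    rw [pell_succ, assocPell_succ, pow_succ (-1), ← ih]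
    ring

theorem pell_nonneg_and_one_le_assocPell (n : ℕ) : 0 ≤ pell n ∧ 1 ≤ assocPell n := by
  induction n with
  | zero => simp [pell, assocPell]
  | succ n ih =>
    rw [pell_succ, assocPell_succ]
    constructor <;> linarith

theorem sum_assocPell (n k : ℕ) :
    ∑ i ∈ Finset.Icc 1 k, assocPell (n + i) = pell (n + 1 + k) - pell (n + 1) := by
  induction k with
  | zero => simp
  | succ k ih =>
    rw [Finset.sum_Icc_succ_top (by omega), ih, ← add_assoc (n + 1) k 1, pell_succ (n + 1 + k),
      show n + (k + 1) = n + 1 + k by omega]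
    ring

theorem pell_add_two_mul_sub_of_even {m : ℕ} (hm : Even m) (a : ℕ) :
    pell (a + 2 * m) - pell a = 2 * pell m * assocPell (a + m) := by
  have h := assocPell_sq_sub m
  rw [hm.neg_one_pow] at h
  rw [two_mul, ← add_assoc, (pell_add_and_assocPell_add (a + m) m).1,
    (pell_add_and_assocPell_add a m).1, (pell_add_and_assocPell_add a m).2]
  linear_combination pell a * h

theorem pell_add_two_mul_sub_of_odd {m : ℕ} (hm : Odd m) (a : ℕ) :
    pell (a + 2 * m) - pell a = 2 * assocPell m * pell (a + m) := by
  have h := assocPell_sq_sub m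
  rw [hm.neg_one_pow] at h
  rw [two_mul, ← add_assoc, (pell_add_and_assocPell_add (a + m) m).1,
    (pell_add_and_assocPell_add a m).1, (pell_add_and_assocPell_add a m).2]
  linear_combination -pell a * h

theorem isCoprime_pell_succ (n : ℕ) : IsCoprime (pell n) (pell (n + 1)) := by
  induction n with
  | zero => exact isCoprime_one_right
  | succ n ih =>
    obtain ⟨u, v, h⟩ := ih
    refine ⟨v - 2 * u, u, ?_⟩
    simp only [pell]
    linear_combination h

theorem isCoprime_assocPell_succ (n : ℕ) : IsCoprime (assocPell n) (assocPell (n + 1)) := by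
  induction n with
  | zero => exact isCoprime_one_right
  | succ n ih =>
    obtain ⟨u, v, h⟩ := ih
    refine ⟨v - 2 * u, u, ?_⟩
    simp only [assocPell]
    linear_combination h

theorem isSetGCD_mul_of_isCoprime {S T : ℕ → ℤ} {d : ℤ} (hd : 1 ≤ d) (hS : ∀ n, S n = d * T n)
    (hT : IsCoprime (T 0) (T 1)) : IsSetGCD S d := by
  refine ⟨hd, fun n => ⟨T n, hS n⟩, fun e he => ?_⟩
  obtain ⟨u, v, h⟩ := hT
  have h0 := he 0
  have h1 := he 1
  rw [hS] at h0 h1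
  have hlin : d = d * T 0 * u + d * T 1 * v := by linear_combination -d * h
  rw [hlin]
  exact dvd_add (h0.mul_right u) (h1.mul_right v)

theorem odd_pell_of_odd {k : ℕ} (hk : Odd k) : Odd (pell k) := by
  obtain ⟨j, rfl⟩ := hk
  induction j with
  | zero => simp [pell]
  | succ j ih =>
    rw [show 2 * (j + 1) + 1 = 2 * j + 1 + 2 by ring, pell]
    exact (even_two_mul _).add_odd ih

theorem isSetGCD_pell_add_sub_of_odd {k : ℕ} (hk : Odd k) :
    IsSetGCD (fun n => pell (n + 1 + k) - pell (n + 1)) 1 := by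
  refine ⟨le_rfl, fun n => one_dvd _, fun e he => ?_⟩
  have h0 : e ∣ pell (k + 1) - 1 := by simpa [pell, add_comm] using he 0
  have h1 : e ∣ pell (k + 2) - 2 := by simpa [pell, add_comm] using he 1
  have hP : e ∣ pell k := by
    have h : pell k = pell (k + 2) - 2 - 2 * (pell (k + 1) - 1) := by
      rw [pell]
      ring
    rw [h]
    exact dvd_sub h1 (h0.mul_left 2)
  have h2 : e ∣ 2 := by
    have hc := assocPell_sq_sub k
    rw [hk.neg_one_pow] at hc
    have hs := pell_succ k
    have h : (2 : ℤ) = pell k * (pell k + 2 * pell (k + 1))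
        - (pell (k + 1) - 1) * (pell (k + 1) + 1) := by
      rw [hs]
      linear_combination hc
    rw [h]
    exact dvd_sub (hP.mul_right _) (h0.mul_right _)
  obtain ⟨t, ht⟩ := odd_pell_of_odd hk
  have h : (1 : ℤ) = pell k - 2 * t := by linarith
  rw [h]
  exact dvd_sub hP (h2.mul_right t)

theorem gcd_sums_assocPell (k : ℕ) (hk : 1 ≤ k) :
    (k % 4 = 0 →
      IsSetGCD (fun n => ∑ i ∈ Finset.Icc 1 k, assocPell (n + i)) (2 * pell (k / 2))) ∧
    (k % 4 = 2 →
      IsSetGCD (fun n => ∑ i ∈ Finset.Icc 1 k, assocPell (n + i)) (2 * assocPell (k / 2))) ∧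
    (Odd k →
      IsSetGCD (fun n => ∑ i ∈ Finset.Icc 1 k, assocPell (n + i)) 1) := by
  simp only [sum_assocPell]
  refine ⟨fun h => ?_, fun h => ?_, isSetGCD_pell_add_sub_of_odd⟩
  · obtain ⟨m, rfl⟩ : ∃ m, k = 2 * m := ⟨k / 2, by omega⟩
    have hm : Even m := Nat.even_iff.2 (by omega)
    rw [Nat.mul_div_cancel_left m two_pos]
    refine isSetGCD_mul_of_isCoprime (T := fun n => assocPell (n + 1 + m)) ?_
      (fun n => pell_add_two_mul_sub_of_even hm (n + 1)) ?_
    · obtain ⟨j, rfl⟩ : ∃ j, m = j + 1 := ⟨m - 1, by omega⟩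
      have := pell_succ j
      linarith [pell_nonneg_and_one_le_assocPell j]
    · convert isCoprime_assocPell_succ (0 + 1 + m) using 2
      omega
  · obtain ⟨m, rfl⟩ : ∃ m, k = 2 * m := ⟨k / 2, by omega⟩
    have hm : Odd m := Nat.odd_iff.2 (by omega)
    rw [Nat.mul_div_cancel_left m two_pos]
    refine isSetGCD_mul_of_isCoprime (T := fun n => pell (n + 1 + m)) ?_
      (fun n => pell_add_two_mul_sub_of_odd hm (n + 1)) ?_
    · linarith [(pell_nonneg_and_one_le_assocPell m).2]
    · convert isCoprime_pell_succ (0 + 1 + m) using 2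
      omega
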